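/- arXiv:1601.03911 — 2 statements merged into one kernel-verified Lean document; each statement's English description precedes it below -/
import Mathlib

section
/- Let 1 < α ≤ 2, β₁ = 1/(α−1) and 1/α < β₂ < 1. Then the doubly-indexed limit, as n → ∞ and m → ∞ (along the product filter), of ρ(n,−m)/(n^{1−β₁α} m^{1−β₂α} ln n) exists and equals ∫₀^∞ v^{−β₂} (1+v)^{−β₂(α−1)} dv. -/
open Filter MeasureTheory Real Set

/-- The kernel `V(x,y) = xy/(x^2+y^2)^{(2-α)/2}` with `V(0,0)=0`. -/
noncomputable def V (α : ℝ) : ℝ → ℝ → ℝ := fun x y =>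
  if x = 0 ∧ y = 0 then 0 else x * y / (x ^ 2 + y ^ 2) ^ ((2 - α) / 2)
theorem key_sum (T : ℕ → ℕ → ℝ) (p u v b b' : ℕ → ℝ)
    (hT : Summable (fun q : ℕ × ℕ => T q.1 q.2))
    (hp : Summable p) (hu : Summable u) (hv : Summable v) (hb : Summable b) (hb' : Summable b')
    (hp0 : ∀ i, 0 ≤ p i) (hu0 : ∀ i, 0 ≤ u i) (hv0 : ∀ i, 0 ≤ v i) (hb0 : ∀ i, 0 ≤ b i)
    (hb'0 : ∀ i, 0 ≤ b' i)
    (h : ∀ i j, |T i j - p i * b j| ≤ u i * b j + v i * b' j) :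
    |(∑' i, ∑' j, T i j) - (∑' i, p i) * (∑' j, b j)|
      ≤ (∑' i, u i) * (∑' j, b j) + (∑' i, v i) * (∑' j, b' j) := by
  have h1 : HasSum (fun q : ℕ × ℕ => p q.1 * b q.2) ((∑' i, p i) * (∑' j, b j)) :=
    hp.hasSum.mul hb.hasSum (hp.mul_of_nonneg hb hp0 hb0)
  have h2 : HasSum (fun q : ℕ × ℕ => u q.1 * b q.2) ((∑' i, u i) * (∑' j, b j)) :=
    hu.hasSum.mul hb.hasSum (hu.mul_of_nonneg hb hu0 hb0)
  have h3 : HasSum (fun q : ℕ × ℕ => v q.1 * b' q.2) ((∑' i, v i) * (∑' j, b' j)) :=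
    hv.hasSum.mul hb'.hasSum (hv.mul_of_nonneg hb' hv0 hb'0)
  rw [← hT.tsum_prod (f := fun q : ℕ × ℕ => T q.1 q.2), ← (hT.hasSum.sub h1).tsum_eq]
  exact tsum_of_norm_bounded (f := fun q : ℕ × ℕ => T q.1 q.2 - p q.1 * b q.2) (h2.add h3)
    (fun q => h q.1 q.2)

theorem w_bdd (w : ℕ → ℕ → ℝ)
    (hA1 : Tendsto (fun p : ℕ × ℕ => w p.1 p.2) (atTop ×ˢ atTop) (nhds 1))
    (winf : ℕ → ℝ)
    (hA2 : ∀ i, Tendsto (fun j => w i j) atTop (nhds (winf i)) ∧ 0 < winf i)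
    (wco : ℕ → ℝ)
    (hA3 : ∀ j, Tendsto (fun i => w i j) atTop (nhds (wco j)) ∧ 0 < wco j) :
    ∃ C : ℝ, 1 ≤ C ∧ ∀ i j, |w i j| ≤ C := by
  have e1 : ∀ᶠ p : ℕ × ℕ in atTop ×ˢ atTop, |w p.1 p.2| < 2 :=
    hA1.abs.eventually (gt_mem_nhds (by norm_num))
  rw [prod_atTop_atTop_eq] at e1
  obtain ⟨⟨K, L⟩, hK⟩ := eventually_atTop.1 e1
  have e2 : ∀ i, ∃ C, ∀ j, |w i j| ≤ C := fun i => by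
    obtain ⟨C, hC⟩ := (hA2 i).1.abs.bddAbove_range
    exact ⟨C, fun j => hC ⟨j, rfl⟩⟩
  have e3 : ∀ j, ∃ C, ∀ i, |w i j| ≤ C := fun j => by
    obtain ⟨C, hC⟩ := (hA3 j).1.abs.bddAbove_range
    exact ⟨C, fun i => hC ⟨i, rfl⟩⟩
  choose P hP using e2
  choose Q hQ using e3
  have P0 : ∀ i, 0 ≤ P i := fun i => (abs_nonneg _).trans (hP i 0)
  have Q0 : ∀ i, 0 ≤ Q i := fun i => (abs_nonneg _).trans (hQ i 0)
  have sP : 0 ≤ ∑ i ∈ Finset.range K, P i := Finset.sum_nonneg fun i _ => P0 i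
  have sQ : 0 ≤ ∑ i ∈ Finset.range L, Q i := Finset.sum_nonneg fun i _ => Q0 i
  refine ⟨2 + ∑ i ∈ Finset.range K, P i + ∑ i ∈ Finset.range L, Q i, by linarith, fun i j => ?_⟩
  by_cases hi : i < K
  · have := Finset.single_le_sum (f := P) (fun i _ => P0 i) (Finset.mem_range.2 hi)
    linarith [hP i j]
  by_cases hj : j < L
  · have := Finset.single_le_sum (f := Q) (fun i _ => Q0 i) (Finset.mem_range.2 hj)
    linarith [hQ j i]
  have := hK (i, j) ⟨not_lt.1 hi, not_lt.1 hj⟩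
  simp only at this
  linarith

theorem riemann (g : ℝ → ℝ) (h : ℝ) (hh : 0 < h) (hg0 : ∀ x, 0 < x → 0 ≤ g x)
    (hg : AntitoneOn g (Ioi 0)) (hi : IntegrableOn g (Ioi 0)) :
    Summable (fun j : ℕ => h * g (((j : ℝ) + 1) * h)) ∧
    ∑' j : ℕ, h * g (((j : ℝ) + 1) * h) ≤ ∫ x in Ioi 0, g x ∧
    ∫ x in Ioi h, g x ≤ ∑' j : ℕ, h * g (((j : ℝ) + 1) * h) := by
  have hU : ∀ a : ℝ, 0 ≤ a → HasSum (fun j : ℕ => ∫ x in Ioc (a + j * h) (a + (j + 1) * h), g x)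
      (∫ x in Ioi a, g x) := by
    intro a ha
    have hun : (⋃ j : ℕ, Ioc (a + j * h) (a + (j + 1) * h)) = Ioi a := by
      ext x
      simp only [mem_iUnion, mem_Ioc, mem_Ioi]
      constructor
      · rintro ⟨j, h1, h2⟩
        have : 0 ≤ (j : ℝ) * h := by positivity
        linarith
      · intro hx
        have hpos : 0 < (x - a) / h := div_pos (by linarith) hh
        have hc : 0 < ⌈(x - a) / h⌉₊ := Nat.ceil_pos.2 hpos
        obtain ⟨k, hk⟩ := Nat.exists_eq_succ_of_ne_zero hc.ne'
        refine ⟨k, ?_, ?_⟩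
        · have : (k : ℝ) < (x - a) / h := Nat.lt_ceil.1 (by omega)
          rw [lt_div_iff₀ hh] at this; linarith
        · have := Nat.le_ceil ((x - a) / h)
          rw [hk, div_le_iff₀ hh] at this; push_cast at this; linarith
    have := hasSum_integral_iUnion (μ := volume) (f := g)
      (s := fun j : ℕ => Ioc (a + j * h) (a + (j + 1) * h)) (fun _ => measurableSet_Ioc) ?_ ?_
    · rwa [hun] at this
    · intro i j hij
      have key : ∀ i j : ℕ, i < j →
          Disjoint (Ioc (a + i * h) (a + (i + 1) * h)) (Ioc (a + j * h) (a + (j + 1) * h)) := by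
        intro i j hij
        rw [Set.disjoint_left]
        rintro x ⟨_, h2⟩ ⟨h3, _⟩
        have : (i : ℝ) + 1 ≤ j := by exact_mod_cast hij
        nlinarith
      rcases lt_or_gt_of_ne hij with h1 | h1
      · exact key i j h1
      · exact (key j i h1).symm
    · rw [hun]; exact hi.mono_set (Ioi_subset_Ioi ha)
  have hI : ∀ a b : ℝ, 0 ≤ a → IntegrableOn g (Ioc a b) := fun a b ha =>
    hi.mono_set (fun x hx => lt_of_le_of_lt ha hx.1)
  have vol : ∀ a b c : ℝ, a ≤ b → ∫ x in Ioc a b, c = (b - a) * c := by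
    intro a b c hab
    simp [hab]
  have up : ∀ j : ℕ, h * g (((j : ℝ) + 1) * h) ≤ ∫ x in Ioc (0 + j * h) (0 + (j + 1) * h), g x := by
    intro j
    have hj : (0 : ℝ) ≤ j * h := by positivity
    have := vol (0 + j * h) (0 + (j + 1) * h) (g (((j : ℝ) + 1) * h)) (by nlinarith)
    have e : (0 + ((j : ℝ) + 1) * h - (0 + j * h)) = h := by ring
    rw [e] at this
    rw [← this]
    refine setIntegral_mono_on (by simp [IntegrableOn]) (hI _ _ (by linarith)) measurableSet_Ioc ?_
    intro x hx
    exact hg (show 0 < x by linarith [hx.1]) (show 0 < ((j : ℝ) + 1) * h by positivity)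
      (by linarith [hx.2])
  have lo : ∀ j : ℕ, ∫ x in Ioc (h + j * h) (h + (j + 1) * h), g x ≤ h * g (((j : ℝ) + 1) * h) := by
    intro j
    have hj : (0 : ℝ) ≤ j * h := by positivity
    have := vol (h + j * h) (h + (j + 1) * h) (g (((j : ℝ) + 1) * h)) (by nlinarith)
    have e : (h + ((j : ℝ) + 1) * h - (h + j * h)) = h := by ring
    rw [e] at this
    rw [← this]
    refine setIntegral_mono_on (hI _ _ (by linarith)) (by simp [IntegrableOn]) measurableSet_Ioc ?_
    intro x hx
    exact hg (show 0 < ((j : ℝ) + 1) * h by positivity) (show 0 < x by linarith [hx.1])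
      (by linarith [hx.1])
  have s0 := hU 0 le_rfl
  have s1 := hU h hh.le
  have S : Summable (fun j : ℕ => h * g (((j : ℝ) + 1) * h)) :=
    Summable.of_nonneg_of_le (fun j => mul_nonneg hh.le (hg0 _ (by positivity))) up s0.summable
  exact ⟨S, hasSum_le up S.hasSum s0, hasSum_le lo s1 S.hasSum⟩

theorem g_anti (β γ : ℝ) (hβ : 0 < β) (hγ : 0 ≤ γ) :
    AntitoneOn (fun v : ℝ => v ^ (-β) * (1 + v) ^ (-γ)) (Ioi 0) := by
  intro x hx y hy hxy
  have hx : 0 < x := hx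
  have hy : 0 < y := hy
  have h1 : y ^ (-β) ≤ x ^ (-β) := rpow_le_rpow_of_nonpos hx hxy (by linarith)
  have h2 : (1 + y) ^ (-γ) ≤ (1 + x) ^ (-γ) :=
    rpow_le_rpow_of_nonpos (by linarith) (by linarith) (by linarith)
  exact mul_le_mul h1 h2 (by positivity) (by positivity)

theorem g_int (β γ : ℝ) (hβ : 0 < β) (hβ1 : β < 1) (hγ : 0 ≤ γ) (h : 1 < β + γ) :
    IntegrableOn (fun v : ℝ => v ^ (-β) * (1 + v) ^ (-γ)) (Ioi 0) := by
  have m : ∀ s : Set ℝ, AEStronglyMeasurable (fun v : ℝ => v ^ (-β) * (1 + v) ^ (-γ))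
      (volume.restrict s) := fun s => by
    apply Measurable.aestronglyMeasurable; fun_prop
  rw [← Ioc_union_Ioi_eq_Ioi (zero_le_one (α := ℝ))]
  refine IntegrableOn.union ?_ ?_
  · have : IntegrableOn (fun v : ℝ => v ^ (-β)) (Ioc 0 1) := by
      rw [← intervalIntegrable_iff_integrableOn_Ioc_of_le zero_le_one]
      exact intervalIntegral.intervalIntegrable_rpow' (by linarith)
    refine Integrable.mono' this (m _) ?_
    filter_upwards [ae_restrict_mem measurableSet_Ioc] with x hx
    have hx0 : 0 < x := hx.1
    rw [norm_of_nonneg (by positivity)]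
    exact mul_le_of_le_one_right (by positivity)
      (rpow_le_one_of_one_le_of_nonpos (by linarith) (by linarith))
  · have : IntegrableOn (fun v : ℝ => v ^ (-β-γ)) (Ioi 1) :=
      integrableOn_Ioi_rpow_of_lt (by linarith) one_pos
    refine Integrable.mono' this (m _) ?_
    filter_upwards [ae_restrict_mem measurableSet_Ioi] with x hx
    have hx0 : 0 < x := lt_trans one_pos hx
    rw [norm_of_nonneg (by positivity), sub_eq_add_neg, rpow_add hx0]
    exact mul_le_mul_of_nonneg_left
      (rpow_le_rpow_of_nonpos hx0 (by linarith) (by linarith)) (by positivity)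

theorem int_tail (g : ℝ → ℝ) (hi : IntegrableOn g (Ioi 0)) :
    Tendsto (fun k : ℕ => ∫ x in Ioi ((k : ℝ)⁻¹), g x) atTop (nhds (∫ x in Ioi 0, g x)) := by
  rw [← tendsto_add_atTop_iff_nat 1]
  have hun : (⋃ k : ℕ, Ioi ((((k + 1 : ℕ) : ℝ))⁻¹)) = Ioi 0 := by
    ext x
    simp only [mem_iUnion, mem_Ioi]
    constructor
    · rintro ⟨k, hk⟩
      exact lt_trans (by positivity) hk
    · intro hx
      obtain ⟨k, hk⟩ := exists_nat_one_div_lt hx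
      exact ⟨k, by simpa using hk⟩
  have := tendsto_setIntegral_of_monotone (μ := volume) (f := g)
    (s := fun k : ℕ => Ioi ((((k + 1 : ℕ) : ℝ))⁻¹)) (fun _ => measurableSet_Ioi) ?_ ?_
  · rwa [hun] at this
  · intro k l hkl
    apply Ioi_subset_Ioi
    have : (k : ℝ) ≤ l := by exact_mod_cast hkl
    push_cast
    gcongr
  · rw [hun]; exact hi

theorem harm : Tendsto (fun n : ℕ => (∑ i ∈ Finset.range n, (1 : ℝ) / (1 + i)) / Real.log n) atTop
    (nhds 1) := by
  have h1 := Real.tendsto_harmonic_sub_log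
  have hl : Tendsto (fun n : ℕ => Real.log (n : ℝ)) atTop atTop :=
    Real.tendsto_log_atTop.comp tendsto_natCast_atTop_atTop
  have h2 := (h1.div_atTop hl).add_const 1
  rw [zero_add] at h2
  refine h2.congr' ?_
  filter_upwards [hl.eventually_gt_atTop 0] with n hn
  have : ((harmonic n : ℚ) : ℝ) = ∑ i ∈ Finset.range n, (1 : ℝ) / (1 + i) := by
    simp [harmonic, add_comm]
  rw [this]
  field_simp
  ring

theorem tail_sum (n : ℕ) (hn : 1 ≤ n) :
    Summable (fun i : ℕ => if i < n then (0 : ℝ) else n / (1 + (i : ℝ)) ^ 2) ∧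
    ∑' i : ℕ, (if i < n then (0 : ℝ) else n / (1 + (i : ℝ)) ^ 2) ≤ 1 := by
  have hn0 : (0 : ℝ) < n := by exact_mod_cast hn
  set f := fun i : ℕ => (if i < n then (0 : ℝ) else n / (1 + (i : ℝ)) ^ 2) with hf
  have hf0 : ∀ i, 0 ≤ f i := fun i => by
    simp only [hf]; split_ifs <;> positivity
  have hpart : ∀ N : ℕ, ∑ i ∈ Finset.range N, f i ≤ if N ≤ n then (0 : ℝ) else 1 - (n : ℝ) / N := by
    intro N
    induction N with
    | zero => simp
    | succ N ih =>
      rw [Finset.sum_range_succ]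
      by_cases h1 : N < n
      · rw [if_pos h1.le] at ih
        rw [if_pos (by omega)]
        simp only [hf, if_pos h1] at ih ⊢
        linarith
      · rw [if_neg (by omega)]
        have hN : (0 : ℝ) < N := by exact_mod_cast (by omega : 0 < N)
        have ih' : ∑ i ∈ Finset.range N, f i ≤ 1 - n / N := by
          refine ih.trans ?_
          split_ifs with h2
          · have : N = n := by omega
            subst this
            rw [div_self hN.ne']; simp
          · exact le_rfl
        have : f N ≤ n / N - n / ((N + 1 : ℕ) : ℝ) := by
          simp only [hf, if_neg h1]
          push_cast
          rw [div_sub_div _ _ hN.ne' (by positivity), div_le_div_iff₀ (by positivity) (by positivity)]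
          nlinarith [mul_pos hn0 hN]
        linarith
  have hb : ∀ N : ℕ, ∑ i ∈ Finset.range N, f i ≤ 1 := fun N => by
    refine (hpart N).trans ?_
    split_ifs
    · norm_num
    · have : (0 : ℝ) ≤ n / N := by positivity
      linarith
  exact ⟨summable_of_sum_range_le hf0 hb, Real.tsum_le_of_sum_range_le hf0 hb⟩

noncomputable def psi (α s t r : ℝ) : ℝ := s * t / (s ^ 2 * r ^ 2 + t ^ 2) ^ ((2 - α) / 2)

theorem V_eq (α s t X Y : ℝ) (ht : t ≠ 0) (hX : 0 < X) (hY : 0 < Y) :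
    V α (s * X) (t * Y) = psi α s t (X / Y) * (X * Y ^ (α - 1)) := by
  have hne : ¬ (s * X = 0 ∧ t * Y = 0) := fun h => (mul_ne_zero ht hY.ne') h.2
  have hpos : 0 < s ^ 2 * (X / Y) ^ 2 + t ^ 2 := by positivity
  have e : (s * X) ^ 2 + (t * Y) ^ 2 = Y ^ 2 * (s ^ 2 * (X / Y) ^ 2 + t ^ 2) := by
    field_simp
  have e2 : (Y ^ 2) ^ ((2 - α) / 2) = Y ^ (2 - α) := by
    rw [← rpow_natCast, ← rpow_mul hY.le]; congr 1; push_cast; ring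
  have e3 : Y ^ (α - 1) * Y ^ (2 - α) = Y := by
    rw [← rpow_add hY]; ring_nf; exact rpow_one Y
  have p1 : 0 < Y ^ (2 - α) := by positivity
  have p2 : 0 < (s ^ 2 * (X / Y) ^ 2 + t ^ 2) ^ ((2 - α) / 2) := by positivity
  simp only [V, if_neg hne, psi]
  rw [e, mul_rpow (by positivity) hpos.le, e2]
  rw [div_mul_eq_mul_div, div_eq_div_iff (by positivity) p2.ne']
  nth_rewrite 1 [← e3]
  ring

theorem psi_bd (α s t r C : ℝ) (hα : 1 < α) (hα2 : α ≤ 2) (ht : t ≠ 0) (hs : |s| ≤ C) (htC : |t| ≤ C) :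
    |psi α s t r| ≤ C * C ^ (α - 1) := by
  have ht' : 0 < |t| := abs_pos.2 ht
  have hC : 0 < C := ht'.trans_le htC
  have h1 : |t| ^ (2 - α) ≤ (s ^ 2 * r ^ 2 + t ^ 2) ^ ((2 - α) / 2) := by
    have : |t| ^ (2 - α) = (t ^ 2) ^ ((2 - α) / 2) := by
      rw [← sq_abs, ← rpow_natCast, ← rpow_mul ht'.le]; congr 1; push_cast; ring
    rw [this]
    exact rpow_le_rpow (by positivity) (by nlinarith [mul_nonneg (sq_nonneg s) (sq_nonneg r)]) (by linarith)
  have e3 : |t| ^ (α - 1) * |t| ^ (2 - α) = |t| := by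
    rw [← rpow_add ht']; ring_nf; exact rpow_one _
  have p1 : 0 < |t| ^ (2 - α) := by positivity
  have p2 := p1.trans_le h1
  unfold psi
  rw [abs_div, abs_mul, abs_of_pos p2]
  calc |s| * |t| / (s ^ 2 * r ^ 2 + t ^ 2) ^ ((2 - α) / 2) ≤ |s| * |t| / |t| ^ (2 - α) := by gcongr
    _ = |s| * |t| ^ (α - 1) := by
      rw [div_eq_iff p1.ne', mul_assoc, e3]
    _ ≤ C * C ^ (α - 1) := by
      have : |t| ^ (α - 1) ≤ C ^ (α - 1) := rpow_le_rpow ht'.le htC (by linarith)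
      gcongr

theorem psi_cont (α ε : ℝ) (hε : 0 < ε) : ∃ η > 0, ∀ s t r κ : ℝ, |s - 1| < η → |t - 1| < η →
    |r| < η → |κ - 1| < η → |psi α s t r * κ - 1| < ε := by
  have h : ContinuousAt (fun q : ℝ × ℝ × ℝ × ℝ => psi α q.1 q.2.1 q.2.2.1 * q.2.2.2) (1, 1, 0, 1) := by
    unfold psi
    refine ContinuousAt.mul (ContinuousAt.div (by fun_prop) ?_ ?_) (by fun_prop)
    · refine ContinuousAt.rpow_const (by fun_prop) (Or.inl (by norm_num))
    · norm_num
  obtain ⟨η, hη, H⟩ := Metric.continuousAt_iff.1 h ε hε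
  refine ⟨η, hη, fun s t r κ h1 h2 h3 h4 => ?_⟩
  have := @H (s, t, r, κ) (by
    simp only [Prod.dist_eq, Real.dist_eq, sub_zero]
    simp [h1, h2, h3, h4])
  simp only [Real.dist_eq] at this
  have e : psi α 1 1 0 * 1 = 1 := by norm_num [psi]
  rwa [e] at this

theorem T_eq (α β₁ β₂ s t L : ℝ) (hα : 1 < α) (hβ₁ : β₁ = 1 / (α - 1)) (n m i j : ℕ)
    (hn : 1 ≤ n) (hm : 1 ≤ m) (ht : t ≠ 0) (hL : 0 < L) :
    V α (s * (1 + ((i + n : ℕ) : ℝ)) ^ (-β₁) * (1 + (j : ℝ)) ^ (-β₂))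
      (t * (1 + (i : ℝ)) ^ (-β₁) * (1 + ((j + m : ℕ) : ℝ)) ^ (-β₂)) /
      ((n : ℝ) ^ (1 - β₁ * α) * (m : ℝ) ^ (1 - β₂ * α) * L) =
    psi α s t (((1 + (i : ℝ)) / (1 + i + n)) ^ β₁ * ((1 + (j : ℝ) + m) / (1 + j)) ^ β₂) *
      ((n : ℝ) / (1 + i + n)) ^ β₁ * (1 / ((1 + i) * L)) *
      ((m : ℝ)⁻¹ * ((((j : ℝ) + 1) * (m : ℝ)⁻¹) ^ (-β₂) *
        (1 + ((j : ℝ) + 1) * (m : ℝ)⁻¹) ^ (-(β₂ * (α - 1))))) := by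
  have hn0 : (0 : ℝ) < n := by exact_mod_cast hn
  have hm0 : (0 : ℝ) < m := by exact_mod_cast hm
  have ha : α - 1 ≠ 0 := by linarith
  have hb : β₁ * (α - 1) = 1 := by rw [hβ₁]; field_simp
  push_cast
  have a1 : (0 : ℝ) < 1 + i := by positivity
  have a2 : (0 : ℝ) < 1 + j := by positivity
  have a3 : (0 : ℝ) < 1 + i + n := by positivity
  have a4 : (0 : ℝ) < 1 + j + m := by positivity
  rw [← add_assoc, ← add_assoc, mul_assoc s, mul_assoc t,
    V_eq _ _ _ _ _ ht (by positivity) (by positivity)]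
  have e1 : (1 + (i : ℝ) + n) ^ (-β₁) * (1 + (j : ℝ)) ^ (-β₂) /
      ((1 + (i : ℝ)) ^ (-β₁) * (1 + (j : ℝ) + m) ^ (-β₂)) =
      ((1 + (i : ℝ)) / (1 + i + n)) ^ β₁ * ((1 + (j : ℝ) + m) / (1 + j)) ^ β₂ := by
    rw [div_rpow a1.le a3.le, div_rpow a4.le a2.le]
    simp only [rpow_neg a1.le, rpow_neg a2.le, rpow_neg a3.le, rpow_neg a4.le]
    field_simp
  rw [e1]
  have e2 : ((1 + (i : ℝ)) ^ (-β₁) * (1 + (j : ℝ) + m) ^ (-β₂)) ^ (α - 1) =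
      (1 + (i : ℝ))⁻¹ * (1 + (j : ℝ) + m) ^ (-(β₂ * (α - 1))) := by
    rw [mul_rpow (by positivity) (by positivity), ← rpow_mul a1.le, ← rpow_mul a4.le]
    rw [neg_mul, neg_mul, hb, rpow_neg_one]
  rw [e2]
  have e3 : ((j : ℝ) + 1) * (m : ℝ)⁻¹ = (1 + j) / m := by rw [add_comm]; rfl
  have e4 : 1 + (1 + (j : ℝ)) / m = (1 + j + m) / m := by field_simp; ring
  have e5 : (n : ℝ) ^ (1 - β₁ * α) = ((n : ℝ) ^ β₁)⁻¹ := by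
    rw [← rpow_neg hn0.le]; congr 1; linarith
  have e6 : (m : ℝ) ^ (1 - β₂ * α) = m * ((m : ℝ) ^ (-β₂) * (m : ℝ) ^ (-(β₂ * (α - 1)))) := by
    have : 1 - β₂ * α = 1 + (-β₂ + -(β₂ * (α - 1))) := by ring
    rw [this, rpow_add hm0, rpow_add hm0, rpow_one]
  rw [e3, e4, e5, e6, div_rpow a2.le hm0.le, div_rpow a4.le hm0.le, div_rpow hn0.le a3.le,
    rpow_neg a3.le]
  field_simp

theorem hasSum_ite (n : ℕ) (f : ℕ → ℝ) :
    HasSum (fun i => if i < n then f i else 0) (∑ i ∈ Finset.range n, f i) := by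
  have := hasSum_sum_of_ne_finset_zero (f := fun i => if i < n then f i else 0)
    (s := Finset.range n) (L := SummationFilter.unconditional ℕ) (fun i hi => if_neg (by simpa using hi))
  convert this using 1
  exact Finset.sum_congr rfl fun i hi => (if_pos (Finset.mem_range.1 hi)).symm

set_option maxHeartbeats 2000000 in
theorem ptwise (α β₁ β₂ : ℝ)
    (hα : 1 < α) (hα2 : α ≤ 2)
    (hβ₁ : β₁ = 1 / (α - 1)) (hβ₂0 : 0 < β₂)
    (w : ℕ → ℕ → ℝ) (hw : ∀ i j, w i j ≠ 0) (C M : ℝ) (hC1 : 1 ≤ C) (hC : ∀ i j, |w i j| ≤ C)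
    (hM : M = C * C ^ (α - 1) + 1)
    (ε η δ δ' L : ℝ) (hε : 0 < ε) (hδ : 0 < δ) (hδ' : 0 < δ') (hL : 0 < L)
    (hη : ∀ s t r κ : ℝ, |s - 1| < η → |t - 1| < η →
    |r| < η → |κ - 1| < η → |psi α s t r * κ - 1| < ε)
    (hδ1 : δ ^ β₁ * (1 + 1 / δ') ^ β₂ < η) (hδ2 : 1 - η < (1 / (1 + δ)) ^ β₁)
    (K : ℕ) (hK : ∀ i j, K ≤ i → K ≤ j → |w i j - 1| < η)
    (n m : ℕ) (hn : 1 ≤ n) (hm : 1 ≤ m) (hmK : (K : ℝ) + 1 ≤ δ' * m) (i j : ℕ)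
    (κ r b b' : ℝ) (hb : 0 ≤ b) (hb' : 0 ≤ b') (hbb : (j : ℝ) + 1 ≤ δ' * m → b' = b)
    (hr : r = ((1 + (i : ℝ)) / (1 + i + n)) ^ β₁ * ((1 + (j : ℝ) + m) / (1 + j)) ^ β₂)
    (hκ : κ = ((n : ℝ) / (1 + i + n)) ^ β₁) :
    |psi α (w (i + n) j) (w i (j + m)) r * κ * (1 / ((1 + i) * L)) * b -
      (if i < n then 1 / ((1 + i) * L) else 0) * b| ≤
      (ε * (if i < n then 1 / ((1 + i) * L) else 0) + M * (if i < K then 1 / L else 0) +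
        M * (if i < n then 1 / (δ * n * L) else 0) +
        M / L * (if i < n then 0 else n / (1 + (i : ℝ)) ^ 2)) * b +
      M * (if i < n then 1 / ((1 + i) * L) else 0) * b' := by
  have hn0 : (0 : ℝ) < n := by exact_mod_cast hn
  have hm0 : (0 : ℝ) < m := by exact_mod_cast hm
  have hβ0 : 1 ≤ β₁ := by
    rw [hβ₁, le_div_iff₀ (by linarith)]; linarith
  have a1 : (0 : ℝ) < 1 + i := by positivity
  have a2 : (0 : ℝ) < 1 + j := by positivity
  have hM0 : 0 < M := by rw [hM]; positivity
  have hpsi := psi_bd α (w (i + n) j) (w i (j + m)) r C hα hα2 (hw _ _) (hC _ _) (hC _ _)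
  set P := psi α (w (i + n) j) (w i (j + m)) r with hP
  have hκ0 : 0 ≤ κ := by rw [hκ]; positivity
  have hκ1 : κ ≤ 1 := by
    rw [hκ]; apply rpow_le_one (by positivity) _ (by linarith)
    rw [div_le_one (by positivity)]; linarith
  have i1 : 0 ≤ (if i < K then 1 / L else 0) := by split_ifs <;> positivity
  by_cases hin : i < n
  · simp only [if_pos hin, mul_zero, add_zero]
    set p := 1 / ((1 + (i : ℝ)) * L) with hp
    have hp0 : 0 < p := by positivity
    have hq0 : 0 < 1 / (δ * n * L) := by positivity
    have hPk : |P * κ - 1| ≤ M := by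
      calc |P * κ - 1| ≤ |P * κ| + |1| := abs_sub _ _
        _ = |P| * κ + 1 := by rw [abs_mul, abs_of_nonneg hκ0, abs_one]
        _ ≤ M := by rw [hM]; nlinarith [abs_nonneg P]
    have e : P * κ * p * b - p * b = (P * κ - 1) * (p * b) := by ring
    rw [e, abs_mul, abs_of_nonneg (by positivity : 0 ≤ p * b)]
    have t1 : 0 ≤ ε * p * b := by positivity
    have t2 : 0 ≤ M * (if i < K then 1 / L else 0) * b := by positivity
    have t3 : 0 ≤ M * (1 / (δ * n * L)) * b := by positivity
    have t4 : 0 ≤ M * p * b' := by positivity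
    have base : |P * κ - 1| * (p * b) ≤ M * p * b := by
      rw [mul_assoc M]; gcongr
    by_cases c1 : i < K
    · have : M * p * b ≤ M * (if i < K then 1 / L else 0) * b := by
        rw [if_pos c1]; 
        have : p ≤ 1 / L := by
          rw [hp]; apply one_div_le_one_div_of_le hL; nlinarith [(Nat.cast_nonneg i : (0:ℝ) ≤ i)]
        gcongr
      linarith
    by_cases c2 : (1 + i : ℝ) ≤ δ * n
    swap
    · have : M * p * b ≤ M * (1 / (δ * n * L)) * b := by
        have : p ≤ 1 / (δ * n * L) := by
          rw [hp]; apply one_div_le_one_div_of_le (by positivity)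
          push Not at c2
          gcongr
        gcongr
      linarith
    by_cases c3 : (j : ℝ) + 1 ≤ δ' * m
    · rw [hbb c3] at t4 ⊢
      linarith
    push Not at c1 c3
    have hj : K ≤ j := by
      have : (K : ℝ) < j := by linarith
      exact_mod_cast this.le
    have hr0 : 0 ≤ r := by rw [hr]; positivity
    have r1 : |r| < η := by
      rw [abs_of_nonneg hr0]
      refine lt_of_le_of_lt ?_ hδ1
      rw [hr]
      have q1 : (1 + (i : ℝ)) / (1 + i + n) ≤ δ := by
        rw [div_le_iff₀ (by positivity)]; nlinarith
      have q2 : (1 + (j : ℝ) + m) / (1 + j) ≤ 1 + 1 / δ' := by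
        rw [div_le_iff₀ (by positivity)]
        have : (m : ℝ) ≤ 1 / δ' * (1 + j) := by
          rw [one_div, inv_mul_eq_div, le_div_iff₀ hδ']; linarith
        linarith
      have q3 := rpow_le_rpow (by positivity) q1 (by linarith : 0 ≤ β₁)
      have q4 := rpow_le_rpow (by positivity) q2 hβ₂0.le
      gcongr
    have k1 : |κ - 1| < η := by
      have : (1 / (1 + δ)) ^ β₁ ≤ κ := by
        rw [hκ]
        refine rpow_le_rpow (by positivity) ?_ (by linarith)
        rw [div_le_div_iff₀ (by positivity) (by positivity)]; linarith
      rw [abs_lt]; constructor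
      · linarith
      · linarith [abs_nonneg r]
    have := hη _ _ _ _ (hK (i + n) j (by omega) hj) (hK i (j + m) c1 (by omega)) r1 k1
    rw [← hP] at this
    have : |P * κ - 1| * (p * b) ≤ ε * (p * b) := by gcongr
    linarith
  · simp only [if_neg hin, mul_zero, zero_mul, sub_zero, add_zero, zero_add]
    push Not at hin
    have hin' : (n : ℝ) ≤ i := by exact_mod_cast hin
    have k2 : κ ≤ n / (1 + i) := by
      rw [hκ]
      calc ((n : ℝ) / (1 + i + n)) ^ β₁ ≤ ((n : ℝ) / (1 + i + n)) ^ (1 : ℝ) := by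
            apply rpow_le_rpow_of_exponent_ge (by positivity) _ hβ0
            rw [div_le_one (by positivity)]; linarith
        _ = (n : ℝ) / (1 + i + n) := rpow_one _
        _ ≤ n / (1 + i) := div_le_div_of_nonneg_left hn0.le a1 (by linarith)
    rw [abs_mul, abs_mul, abs_mul, abs_of_nonneg hκ0, abs_of_nonneg hb,
      abs_of_nonneg (by positivity : 0 ≤ 1 / ((1 + (i : ℝ)) * L))]
    have : |P| * κ * (1 / ((1 + i) * L)) ≤ M * (n / (1 + i)) * (1 / ((1 + i) * L)) := by
      have : |P| ≤ M := by linarith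
      gcongr
    have e : M * ((n : ℝ) / (1 + i)) * (1 / ((1 + i) * L)) = M / L * (n / (1 + (i : ℝ)) ^ 2) := by
      field_simp
    rw [e] at this
    have t : 0 ≤ M * (if i < K then 1 / L else 0) * b := by positivity
    nlinarith [mul_le_mul_of_nonneg_right this hb]

set_option maxHeartbeats 2000000 in
theorem stmt8 (α β₁ β₂ : ℝ)
    (hα : 1 < α) (hα2 : α ≤ 2)
    (hβ₁ : β₁ = 1 / (α - 1)) (hβ₂l : 1 / α < β₂) (hβ₂u : β₂ < 1)
    (w : ℕ → ℕ → ℝ) (hw : ∀ i j, w i j ≠ 0)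
    (hA1 : Tendsto (fun p : ℕ × ℕ => w p.1 p.2) (atTop ×ˢ atTop) (nhds 1))
    (winf : ℕ → ℝ)
    (hA2 : ∀ i, Tendsto (fun j => w i j) atTop (nhds (winf i)) ∧ 0 < winf i)
    (wco : ℕ → ℝ)
    (hA3 : ∀ j, Tendsto (fun i => w i j) atTop (nhds (wco j)) ∧ 0 < wco j)
    (c : ℕ → ℕ → ℝ)
    (hc : ∀ i j, c i j = w i j * (1 + (i : ℝ)) ^ (-β₁) * (1 + (j : ℝ)) ^ (-β₂))
    (ρ : ℕ → ℕ → ℝ)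
    (hsum : ∀ n m : ℕ, 1 ≤ n → 1 ≤ m →
      Summable (fun q : ℕ × ℕ => V α (c (q.1 + n) q.2) (c q.1 (q.2 + m))))
    (hρ : ∀ n m : ℕ, 1 ≤ n → 1 ≤ m →
      ρ n m = ∑' i : ℕ, ∑' j : ℕ, V α (c (i + n) j) (c i (j + m)))
    :
    Tendsto (fun p : ℕ × ℕ => ρ p.1 p.2 / ((p.1 : ℝ) ^ (1 - β₁ * α) * (p.2 : ℝ) ^ (1 - β₂ * α) * Real.log p.1))
      (atTop ×ˢ atTop)
      (nhds (∫ v in Ioi (0 : ℝ), v ^ (-β₂) * (1 + v) ^ (-(β₂ * (α - 1))))) := by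
  have hβ₂0 : 0 < β₂ := lt_trans (by positivity) hβ₂l
  have hβ₁0 : 0 < β₁ := by rw [hβ₁]; exact one_div_pos.2 (by linarith)
  have hγ : 0 ≤ β₂ * (α - 1) := mul_nonneg hβ₂0.le (by linarith)
  have hβα : 1 < β₂ + β₂ * (α - 1) := by
    rw [div_lt_iff₀ (by linarith)] at hβ₂l; linarith
  obtain ⟨C, hC1, hC⟩ := w_bdd w hA1 winf hA2 wco hA3
  set g : ℝ → ℝ := fun v => v ^ (-β₂) * (1 + v) ^ (-(β₂ * (α - 1))) with hg
  have gint : IntegrableOn g (Ioi 0) := g_int _ _ hβ₂0 hβ₂u hγ hβα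
  have ganti : AntitoneOn g (Ioi 0) := g_anti _ _ hβ₂0 hγ
  have g0 : ∀ x, 0 < x → 0 ≤ g x := fun x hx => by simp only [hg]; positivity
  change Tendsto _ _ (nhds (∫ v in Ioi (0 : ℝ), g v))
  set I := ∫ v in Ioi (0 : ℝ), g v with hI
  have hI0 : 0 ≤ I := setIntegral_nonneg measurableSet_Ioi g0
  set M := C * C ^ (α - 1) + 1 with hM
  have hM0 : 0 < M := by positivity
  rw [Metric.tendsto_nhds]
  intro e he
  -- parameters
  set ε := e / (2 * (I + 1)) with hεd
  have hε : 0 < ε := by positivity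
  set ε' := e / (2 * M) with hε'd
  have hε' : 0 < ε' := by positivity
  have hlim : ε * I + M * ε' < e := by
    have h1 : ε * (I + 1) = e / 2 := by rw [hεd]; field_simp
    have h2 : M * ε' = e / 2 := by rw [hε'd]; field_simp
    nlinarith
  have htail := int_tail g gint
  obtain ⟨k, hk, hk1⟩ := ((htail.eventually (lt_mem_nhds (show I - ε' < I by linarith))).and
    (eventually_ge_atTop 1)).exists
  set δ' : ℝ := (k : ℝ)⁻¹ with hδ'd
  have hδ' : 0 < δ' := by
    have : (0 : ℝ) < k := by exact_mod_cast hk1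
    positivity
  set g' : ℝ → ℝ := (Iic δ').indicator g with hg'
  have g'0 : ∀ x, 0 < x → 0 ≤ g' x := fun x hx => by
    simp only [hg', indicator_apply]; split_ifs
    · exact g0 x hx
    · exact le_rfl
  have g'int : IntegrableOn g' (Ioi 0) := gint.indicator measurableSet_Iic
  have g'anti : AntitoneOn g' (Ioi 0) := by
    intro x hx y hy hxy
    by_cases h : y ≤ δ'
    · rw [hg', indicator_of_mem (show y ∈ Iic δ' from h),
        indicator_of_mem (show x ∈ Iic δ' from hxy.trans h)]
      exact ganti hx hy hxy
    · have : g' y = 0 := indicator_of_notMem (show y ∉ Iic δ' from h) _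
      rw [this]; exact g'0 x hx
  have g'I : ∫ x in Ioi 0, g' x ≤ ε' := by
    rw [hg', setIntegral_indicator measurableSet_Iic, Ioi_inter_Iic]
    have h1 := setIntegral_union (μ := volume) (f := g) (Ioc_disjoint_Ioi_same (a := 0) (b := δ'))
      measurableSet_Ioi (gint.mono_set Ioc_subset_Ioi_self) (gint.mono_set (Ioi_subset_Ioi hδ'.le))
    rw [Ioc_union_Ioi_eq_Ioi hδ'.le] at h1
    linarith
  obtain ⟨η, hη0, hη⟩ := psi_cont α ε hε
  obtain ⟨δ, hδ, hδ1, hδ2⟩ : ∃ δ > 0, δ ^ β₁ * (1 + 1 / δ') ^ β₂ < η ∧ 1 - η < (1 / (1 + δ)) ^ β₁ := by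
    have c1 : ContinuousAt (fun δ : ℝ => δ ^ β₁ * (1 + 1 / δ') ^ β₂) 0 :=
      (continuousAt_id.rpow_const (Or.inr hβ₁0.le)).mul continuousAt_const
    have c2 : ContinuousAt (fun δ : ℝ => (1 / (1 + δ)) ^ β₁) 0 := by
      refine ContinuousAt.rpow_const (ContinuousAt.div (by fun_prop) (by fun_prop) (by norm_num))
        (Or.inr hβ₁0.le)
    have d1 := c1.eventually (gt_mem_nhds (show (0 : ℝ) ^ β₁ * (1 + 1 / δ') ^ β₂ < η by simpa [zero_rpow hβ₁0.ne'] using hη0))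
    have d2 := c2.eventually (lt_mem_nhds (show 1 - η < (1 / (1 + (0 : ℝ))) ^ β₁ by simpa using hη0))
    have d3 : ∀ᶠ δ : ℝ in nhdsWithin 0 (Ioi 0), _ := (d1.and d2).filter_mono nhdsWithin_le_nhds
    obtain ⟨δ, h1, h2⟩ := (d3.and self_mem_nhdsWithin).exists
    exact ⟨δ, h2, h1⟩
  obtain ⟨K, hK⟩ : ∃ K : ℕ, ∀ i j, K ≤ i → K ≤ j → |w i j - 1| < η := by
    have := (Metric.tendsto_nhds.1 hA1) η hη0
    rw [prod_atTop_atTop_eq] at this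
    obtain ⟨⟨K, L⟩, h⟩ := eventually_atTop.1 this
    refine ⟨max K L, fun i j hi hj => ?_⟩
    exact h (i, j) ⟨(le_max_left _ _).trans hi, (le_max_right _ _).trans hj⟩
  -- limits
  set P : ℕ → ℝ := fun n => (∑ i ∈ Finset.range n, (1 : ℝ) / (1 + i)) / Real.log n with hPd
  set B : ℕ → ℝ := fun m => ∑' j : ℕ, (m : ℝ)⁻¹ * g (((j : ℝ) + 1) * (m : ℝ)⁻¹) with hBd
  have hl : Tendsto (fun n : ℕ => Real.log (n : ℝ)) atTop atTop :=
    Real.tendsto_log_atTop.comp tendsto_natCast_atTop_atTop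
  have hP1 : Tendsto P atTop (nhds 1) := harm
  have hB : Tendsto B atTop (nhds I) := by
    refine tendsto_of_tendsto_of_tendsto_of_le_of_le' htail tendsto_const_nhds ?_ ?_
    · filter_upwards [eventually_ge_atTop 1] with m hm
      exact (riemann g _ (inv_pos.2 (by exact_mod_cast hm)) g0 ganti gint).2.2
    · filter_upwards [eventually_ge_atTop 1] with m hm
      exact (riemann g _ (inv_pos.2 (by exact_mod_cast hm)) g0 ganti gint).2.1
  set D := M * K + M / δ + M with hD
  have hE : Tendsto (fun p : ℕ × ℕ => (ε * P p.1 + D / Real.log p.1) * B p.2 + M * P p.1 * ε' +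
      |P p.1 * B p.2 - I|) (atTop ×ˢ atTop) (nhds (ε * I + M * ε')) := by
    have p1 := hP1.comp (tendsto_fst (f := atTop) (g := (atTop : Filter ℕ)))
    have p2 := hB.comp (tendsto_snd (g := atTop) (f := (atTop : Filter ℕ)))
    have p3 := ((tendsto_const_nhds (x := D)).div_atTop hl).comp
      (tendsto_fst (f := atTop) (g := (atTop : Filter ℕ)))
    have := ((((p1.const_mul ε).add p3).mul p2).add ((p1.const_mul M).mul_const ε')).add
      ((p1.mul p2).sub_const I).abs
    simpa using this
  have hev := hE.eventually (gt_mem_nhds hlim)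
  have en : ∀ᶠ n : ℕ in atTop, 1 ≤ n ∧ 0 < Real.log n :=
    (eventually_ge_atTop 1).and (hl.eventually_gt_atTop 0)
  have em : ∀ᶠ m : ℕ in atTop, 1 ≤ m ∧ (K : ℝ) + 1 ≤ δ' * m :=
    (eventually_ge_atTop 1).and
      ((tendsto_natCast_atTop_atTop.const_mul_atTop hδ').eventually_ge_atTop _)
  filter_upwards [hev, en.prod_mk em]
  rintro ⟨n, m⟩ hlt ⟨⟨hn, hL⟩, hm, hmK⟩
  simp only at hlt hn hL hm hmK ⊢
  have hn0 : (0 : ℝ) < n := by exact_mod_cast hn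
  have hm0 : (0 : ℝ) < m := by exact_mod_cast hm
  set L := Real.log n with hLd
  rw [Real.dist_eq]
  refine lt_of_le_of_lt ?_ hlt
  have hh : 0 < (m : ℝ)⁻¹ := inv_pos.2 hm0
  obtain ⟨Rs, Ru, Rl⟩ := riemann g _ hh g0 ganti gint
  obtain ⟨Rs', Ru', -⟩ := riemann g' _ hh g'0 g'anti g'int
  have hB0 : 0 ≤ B m := tsum_nonneg fun j => mul_nonneg hh.le (g0 _ (by positivity))
  set p : ℕ → ℝ := fun i => if i < n then 1 / ((1 + (i : ℝ)) * L) else 0 with hp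
  have hps : HasSum p (P n) := by
    have := hasSum_ite n (fun i => 1 / ((1 + (i : ℝ)) * L))
    convert this using 1
    simp only [hPd]
    rw [Finset.sum_div]
    exact Finset.sum_congr rfl fun i _ => by rw [div_div]
  have hp0 : ∀ i, 0 ≤ p i := fun i => by simp only [hp]; split_ifs <;> positivity
  have hPn0 : 0 ≤ P n := hps.nonneg hp0
  obtain ⟨ts, tl⟩ := tail_sum n hn
  set u : ℕ → ℝ := fun i => ε * p i + M * (if i < K then 1 / L else 0) +
        M * (if i < n then 1 / (δ * n * L) else 0) +
        M / L * (if i < n then 0 else n / (1 + (i : ℝ)) ^ 2) with hu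
  have hu0 : ∀ i, 0 ≤ u i := fun i => by
    have := hp0 i
    simp only [hu]
    have a1 : 0 ≤ (if i < K then 1 / L else 0) := by split_ifs <;> positivity
    have a2 : 0 ≤ (if i < n then 1 / (δ * n * L) else 0) := by split_ifs <;> positivity
    have a3 : 0 ≤ (if i < n then 0 else n / (1 + (i : ℝ)) ^ 2) := by split_ifs <;> positivity
    positivity
  have hus := (((hps.mul_left ε).add ((hasSum_ite K (fun _ => 1 / L)).mul_left M)).add
    ((hasSum_ite n (fun _ => 1 / (δ * n * L))).mul_left M)).add (ts.hasSum.mul_left (M / L))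
  have huS : ∑' i, u i ≤ ε * P n + D / L := by
    rw [show ∑' i, u i = _ from hus.tsum_eq]
    simp only [Finset.sum_const, Finset.card_range, nsmul_eq_mul]
    have e1 : M * ((n : ℝ) * (1 / (δ * n * L))) = M / δ / L := by field_simp
    have e2 : D / L = M * (K * (1 / L)) + M / δ / L + M / L * 1 := by
      rw [hD]; field_simp
    rw [e1, e2]
    have := mul_le_mul_of_nonneg_left tl (by positivity : 0 ≤ M / L)
    linarith
  have Teq : ∀ i j : ℕ, V α (c (i + n) j) (c i (j + m)) /
      ((n : ℝ) ^ (1 - β₁ * α) * (m : ℝ) ^ (1 - β₂ * α) * L) =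
      psi α (w (i + n) j) (w i (j + m)) (((1 + (i : ℝ)) / (1 + i + n)) ^ β₁ * ((1 + (j : ℝ) + m) / (1 + j)) ^ β₂) *
      ((n : ℝ) / (1 + i + n)) ^ β₁ * (1 / ((1 + i) * L)) *
      ((m : ℝ)⁻¹ * g (((j : ℝ) + 1) * (m : ℝ)⁻¹)) := fun i j => by
    rw [hc, hc]
    exact T_eq α β₁ β₂ _ _ L hα hβ₁ n m i j hn hm (hw _ _) hL
  have key := key_sum (fun i j => V α (c (i + n) j) (c i (j + m)) /
      ((n : ℝ) ^ (1 - β₁ * α) * (m : ℝ) ^ (1 - β₂ * α) * L)) p u (fun i => M * p i)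
      (fun j => (m : ℝ)⁻¹ * g (((j : ℝ) + 1) * (m : ℝ)⁻¹))
      (fun j => (m : ℝ)⁻¹ * g' (((j : ℝ) + 1) * (m : ℝ)⁻¹))
      ((hsum n m hn hm).div_const _) hps.summable hus.summable (hps.summable.mul_left M)
      Rs Rs' hp0 hu0 (fun i => mul_nonneg hM0.le (hp0 i))
      (fun j => mul_nonneg hh.le (g0 _ (by positivity)))
      (fun j => mul_nonneg hh.le (g'0 _ (by positivity))) (by
        intro i j
        simp only [Teq]
        refine ptwise α β₁ β₂ hα hα2 hβ₁ hβ₂0 w hw C M hC1 hC hM ε η δ δ' L hε hδ hδ' hL hη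
          hδ1 hδ2 K hK n m hn hm hmK i j _ _ _ _
          (mul_nonneg hh.le (g0 _ (by positivity))) (mul_nonneg hh.le (g'0 _ (by positivity)))
          ?_ rfl rfl
        intro hj
        have : ((j : ℝ) + 1) * (m : ℝ)⁻¹ ∈ Iic δ' := by
          rw [mem_Iic, ← div_eq_mul_inv, div_le_iff₀ hm0]; exact hj
        rw [hg', indicator_of_mem this])
  rw [hps.tsum_eq, (hps.mul_left M).tsum_eq] at key
  have hρe : ρ n m / ((n : ℝ) ^ (1 - β₁ * α) * (m : ℝ) ^ (1 - β₂ * α) * L) =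
      ∑' i : ℕ, ∑' j : ℕ, V α (c (i + n) j) (c i (j + m)) /
      ((n : ℝ) ^ (1 - β₁ * α) * (m : ℝ) ^ (1 - β₂ * α) * L) := by
    rw [hρ n m hn hm]
    simp only [tsum_div_const]
  rw [hρe]
  refine (abs_sub_le _ (P n * B m) _).trans ?_
  have k1 := mul_le_mul_of_nonneg_right huS hB0
  have k2 := mul_le_mul_of_nonneg_left (Ru'.trans g'I) (mul_nonneg hM0.le hPn0)
  have key' := key.trans (add_le_add k1 k2)
  exact add_le_add key' le_rfl
end

section
/- Let 1 < α < 2, β₁ > 1/(α−1) and 1 < β₂ < 1/(α−1), and let (m_n) be a sequence of positive integers such that m_n^{−β₂}/n^{−β₁} → 0 as n → ∞. Then lim_{n→∞} ρ(n,−m_n)/(n^{−β₁/β₂} m_n^{1−β₂α}) = Σ_{i=0}^∞ ∫₀^∞ V(v^{−β₂}, w_{(i,∞)} (1+i)^{−β₁}) dv. -/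
open Filter MeasureTheory Real Set

lemma V_eq_s12 (α x y : ℝ) : V α x y = x * y / (x ^ 2 + y ^ 2) ^ ((2 - α) / 2) := by
  unfold V
  split_ifs with h
  · simp [h.1]
  · rfl

lemma V_symm (α x y : ℝ) : V α x y = V α y x := by
  rw [V_eq_s12, V_eq_s12, mul_comm, add_comm]

lemma V_hom (α x y t : ℝ) (ht : 0 < t) : V α (x * t) (y * t) = t ^ α * V α x y := by
  rw [V_eq_s12, V_eq_s12]
  have h1 : (x * t) ^ 2 + (y * t) ^ 2 = (x ^ 2 + y ^ 2) * t ^ 2 := by ring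
  have h2 : (t ^ 2 : ℝ) ^ ((2 - α) / 2) = t ^ (2 - α) := by
    rw [← Real.rpow_natCast t 2, ← Real.rpow_mul ht.le]
    congr 1
    push_cast
    ring
  have h3 : t ^ 2 = t ^ α * t ^ (2 - α) := by
    rw [← Real.rpow_add ht, ← Real.rpow_natCast]
    congr 1
    push_cast
    ring
  rw [h1, Real.mul_rpow (by positivity) (by positivity), h2]
  have h4 : x * t * (y * t) = x * y * t ^ 2 := by ring
  have h5 : 0 < t ^ (2 - α) := Real.rpow_pos_of_pos ht _
  rw [h4, h3]
  rw [← mul_assoc, mul_div_mul_right _ _ h5.ne']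
  ring

lemma V_bound (α x y a b : ℝ) (hα : 1 < α) (hα2 : α < 2) (hx : |x| ≤ a) (hy : |y| ≤ b) :
    |V α x y| ≤ a * b ^ (α - 1) := by
  have ha : 0 ≤ a := (abs_nonneg x).trans hx
  have hb : 0 ≤ b := (abs_nonneg y).trans hy
  have h0 : 0 ≤ a * b ^ (α - 1) := mul_nonneg ha (Real.rpow_nonneg hb _)
  rw [V_eq_s12]
  by_cases hy0 : y = 0
  · simpa [hy0] using h0
  have hyp : 0 < |y| := abs_pos.mpr hy0
  have h2 : |y| ^ (2 - α) ≤ (x ^ 2 + y ^ 2) ^ ((2 - α) / 2) := by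
    have : |y| ^ (2 - α) = (y ^ 2) ^ ((2 - α) / 2) := by
      rw [← sq_abs y, ← Real.rpow_natCast |y| 2, ← Real.rpow_mul hyp.le]
      congr 1
      push_cast
      ring
    rw [this]
    exact Real.rpow_le_rpow (by positivity) (by nlinarith [sq_nonneg x]) (by linarith)
  have h3 : 0 < |y| ^ (2 - α) := Real.rpow_pos_of_pos hyp _
  rw [abs_div, abs_mul, abs_of_pos (h3.trans_le h2)]
  calc |x| * |y| / (x ^ 2 + y ^ 2) ^ ((2 - α) / 2) ≤ |x| * |y| / |y| ^ (2 - α) := by gcongr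
    _ = |x| * |y| ^ (α - 1) := by
      rw [mul_div_assoc]
      congr 1
      rw [show α - 1 = 1 - (2 - α) by ring, Real.rpow_sub hyp 1, Real.rpow_one]
    _ ≤ a * b ^ (α - 1) := by
      apply mul_le_mul hx _ (by positivity) ha
      exact Real.rpow_le_rpow hyp.le hy (by linarith)

lemma V_tendsto {ι : Type*} {l : Filter ι} (α x y : ℝ) (f g : ι → ℝ) (hx : 0 < x)
    (hf : Tendsto f l (nhds x)) (hg : Tendsto g l (nhds y)) :
    Tendsto (fun n => V α (f n) (g n)) l (nhds (V α x y)) := by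
  simp only [V_eq_s12]
  have hp : 0 < x ^ 2 + y ^ 2 := by positivity
  refine (hf.mul hg).div (((hf.pow 2).add (hg.pow 2)).rpow_const (Or.inl hp.ne')) ?_
  exact (Real.rpow_pos_of_pos hp _).ne'

lemma V_meas (α : ℝ) {f g : ℝ → ℝ} (hf : Measurable f) (hg : Measurable g) :
    Measurable (fun v => V α (f v) (g v)) := by
  simp only [V_eq_s12]
  fun_prop

lemma w_bound (w : ℕ → ℕ → ℝ)
    (hA1 : Tendsto (fun p : ℕ × ℕ => w p.1 p.2) (atTop ×ˢ atTop) (nhds 1))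
    (winf : ℕ → ℝ) (hA2 : ∀ i, Tendsto (fun j => w i j) atTop (nhds (winf i)))
    (wco : ℕ → ℝ) (hA3 : ∀ j, Tendsto (fun i => w i j) atTop (nhds (wco j))) :
    ∃ W : ℝ, 0 < W ∧ ∀ i j, |w i j| ≤ W := by
  have h1 : ∀ᶠ p : ℕ × ℕ in atTop ×ˢ atTop, |w p.1 p.2| < 2 := by
    have := hA1.abs
    exact this.eventually_lt_const (by norm_num)
  rw [prod_atTop_atTop_eq, eventually_atTop] at h1
  obtain ⟨⟨N, M⟩, h1⟩ := h1
  have h2 : ∀ i, ∃ A, ∀ j, |w i j| ≤ A := by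
    intro i
    obtain ⟨A, hA⟩ := (hA2 i).abs.bddAbove_range
    exact ⟨A, fun j => hA ⟨j, rfl⟩⟩
  have h3 : ∀ j, ∃ A, ∀ i, |w i j| ≤ A := by
    intro j
    obtain ⟨A, hA⟩ := (hA3 j).abs.bddAbove_range
    exact ⟨A, fun i => hA ⟨i, rfl⟩⟩
  choose A hA using h2
  choose B hB using h3
  have hA0 : ∀ i, 0 ≤ A i := fun i => (abs_nonneg _).trans (hA i 0)
  have hB0 : ∀ i, 0 ≤ B i := fun i => (abs_nonneg _).trans (hB i 0)
  have sA : 0 ≤ ∑ i ∈ Finset.range N, A i := Finset.sum_nonneg fun i _ => hA0 i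
  have sB : 0 ≤ ∑ i ∈ Finset.range M, B i := Finset.sum_nonneg fun i _ => hB0 i
  refine ⟨2 + ∑ i ∈ Finset.range N, A i + ∑ j ∈ Finset.range M, B j, by linarith, ?_⟩
  intro i j
  by_cases hi : i < N
  · have := Finset.single_le_sum (f := A) (fun i _ => hA0 i) (Finset.mem_range.mpr hi)
    linarith [hA i j]
  by_cases hj : j < M
  · have := Finset.single_le_sum (f := B) (fun i _ => hB0 i) (Finset.mem_range.mpr hj)
    linarith [hB j i]
  have := h1 (i, j) ⟨not_lt.mp hi, not_lt.mp hj⟩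
  simp only at this
  linarith

lemma integral_floor (g : ℕ → ℝ) (h : IntegrableOn (fun v : ℝ => g ⌊v⌋₊) (Ioi 0)) :
    ∫ v in Ioi (0 : ℝ), g ⌊v⌋₊ = ∑' j, g j := by
  have hU : (⋃ j : ℕ, Ico (j : ℝ) (j + 1)) = Ici 0 := by
    ext v
    simp only [mem_iUnion, mem_Ico, mem_Ici]
    constructor
    · rintro ⟨j, h1, _⟩
      exact (Nat.cast_nonneg j).trans h1
    · intro hv
      exact ⟨⌊v⌋₊, Nat.floor_le hv, Nat.lt_floor_add_one v⟩
  have h' : IntegrableOn (fun v : ℝ => g ⌊v⌋₊) (⋃ j : ℕ, Ico (j : ℝ) (j + 1)) := by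
    rw [hU, integrableOn_Ici_iff_integrableOn_Ioi]
    exact h
  have hd : Pairwise (Function.onFun Disjoint fun j : ℕ => Ico (j : ℝ) (j + 1)) := by
    intro i j hij
    rw [Function.onFun, Set.disjoint_left]
    rintro v ⟨h1, h2⟩ ⟨h3, h4⟩
    apply hij
    have a : (i : ℝ) < j + 1 := h1.trans_lt h4
    have b : (j : ℝ) < i + 1 := h3.trans_lt h2
    norm_cast at a b
    omega
  have := integral_iUnion (fun j : ℕ => measurableSet_Ico) hd h'
  rw [← integral_Ici_eq_integral_Ioi, ← hU, this]
  congr 1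
  ext j
  rw [setIntegral_congr_fun (g := fun _ => g j) measurableSet_Ico]
  · simp
  · rintro v ⟨h1, h2⟩
    have : ⌊v⌋₊ = j := (Nat.floor_eq_iff ((Nat.cast_nonneg j).trans h1)).mpr ⟨h1, h2⟩
    simp only [this]

lemma integral_floor_mul (g : ℕ → ℝ) (J : ℝ) (hJ : 0 < J)
    (h : IntegrableOn (fun v : ℝ => g ⌊J * v⌋₊) (Ioi 0)) :
    ∫ v in Ioi (0 : ℝ), g ⌊J * v⌋₊ = J⁻¹ * ∑' j, g j := by
  have h1 := integral_comp_mul_left_Ioi (fun v : ℝ => g ⌊v⌋₊) 0 hJ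
  have h2 := (integrableOn_Ioi_comp_mul_left_iff (fun v : ℝ => g ⌊v⌋₊) 0 hJ).mp h
  simp only [mul_zero] at h1 h2
  rw [h1, integral_floor g h2, smul_eq_mul]

noncomputable def Dom (α β₂ : ℝ) (v : ℝ) : ℝ :=
  if v ≤ 1 then v ^ (-(β₂ * (α - 1))) else v ^ (-β₂)

lemma Dom_int (α β₂ : ℝ) (h1 : 1 < β₂) (h2 : β₂ * (α - 1) < 1) :
    IntegrableOn (Dom α β₂) (Ioi 0) := by
  rw [← Ioc_union_Ioi_eq_Ioi (zero_le_one' ℝ)]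
  apply IntegrableOn.union
  · have : IntegrableOn (fun v : ℝ => v ^ (-(β₂ * (α - 1)))) (Ioc 0 1) := by
      rw [← intervalIntegrable_iff_integrableOn_Ioc_of_le zero_le_one]
      exact intervalIntegral.intervalIntegrable_rpow' (by linarith)
    refine this.congr_fun ?_ measurableSet_Ioc
    intro v hv
    simp [Dom, hv.2]
  · have : IntegrableOn (fun v : ℝ => v ^ (-β₂)) (Ioi 1) :=
      integrableOn_Ioi_rpow_of_lt (by linarith) one_pos
    refine this.congr_fun ?_ measurableSet_Ioi
    intro v hv
    simp [Dom, not_le.mpr (mem_Ioi.mp hv)]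

lemma V_dom (α β₁ β₂ W v t x y : ℝ) (hα : 1 < α) (hα2 : α < 2) (hβ₁ : 0 < β₁)
    (hW : 0 < W) (hv : 0 < v) (ht : 1 ≤ t)
    (hx : |x| ≤ W * v ^ (-β₂)) (hy : |y| ≤ W * t ^ (-β₁)) :
    |V α x y| ≤ (W * W ^ (α - 1) * t ^ (-(β₁ * (α - 1)))) * Dom α β₂ v := by
  have ht0 : 0 < t := by linarith
  unfold Dom
  split_ifs with h
  · rw [V_symm]
    refine (V_bound α y x _ _ hα hα2 hy hx).trans ?_
    rw [Real.mul_rpow hW.le (Real.rpow_nonneg hv.le _), ← Real.rpow_mul hv.le, neg_mul]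
    have h1 : t ^ (-β₁) ≤ t ^ (-(β₁ * (α - 1))) :=
      Real.rpow_le_rpow_of_exponent_le ht (by nlinarith)
    have h2 : 0 ≤ v ^ (-(β₂ * (α - 1))) := Real.rpow_nonneg hv.le _
    have h3 : 0 ≤ W ^ (α - 1) := Real.rpow_nonneg hW.le _
    calc W * t ^ (-β₁) * (W ^ (α - 1) * v ^ (-(β₂ * (α - 1))))
        ≤ W * t ^ (-(β₁ * (α - 1))) * (W ^ (α - 1) * v ^ (-(β₂ * (α - 1)))) := by gcongr
      _ = _ := by ring
  · refine (V_bound α x y _ _ hα hα2 hx hy).trans (le_of_eq ?_)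
    rw [Real.mul_rpow hW.le (Real.rpow_nonneg ht0.le _), ← Real.rpow_mul ht0.le, neg_mul]
    ring

lemma x_form (β₁ β₂ a n k m J : ℝ) (ha : 0 < a) (hn : 0 < n) (hk : 0 < k) (hm : 0 < m)
    (hb : β₂ ≠ 0) (hJ : J = m * n ^ (-(β₁ / β₂))) (w : ℝ) :
    w * a ^ (-β₁) * k ^ (-β₂) * m ^ β₂ = w * (a / n) ^ (-β₁) * (k / J) ^ (-β₂) := by
  have hnp : 0 < n ^ (-(β₁ / β₂)) := Real.rpow_pos_of_pos hn _
  have hJ0 : 0 < J := by rw [hJ]; positivity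
  have h1 : J ^ (-β₂) = m ^ (-β₂) * n ^ β₁ := by
    rw [hJ, Real.mul_rpow hm.le hnp.le, ← Real.rpow_mul hn.le]
    congr 2
    field_simp
  rw [Real.div_rpow ha.le hn.le, Real.div_rpow hk.le hJ0.le, h1, Real.rpow_neg hm.le,
    Real.rpow_neg hn.le]
  have := Real.rpow_pos_of_pos hm β₂
  have := Real.rpow_pos_of_pos hn β₁
  field_simp

lemma y_form (β₁ β₂ a k m : ℝ) (hk : 0 < k) (hm : 0 < m) (w : ℝ) :
    w * a ^ (-β₁) * k ^ (-β₂) * m ^ β₂ = w * a ^ (-β₁) * (k / m) ^ (-β₂) := by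
  rw [Real.div_rpow hk.le hm.le, Real.rpow_neg hm.le]
  have := Real.rpow_pos_of_pos hm β₂
  field_simp

theorem stmt12 (α β₁ β₂ : ℝ)
    (hα : 1 < α) (hα2 : α < 2)
    (hβ₁ : 1 / (α - 1) < β₁) (hβ₂l : 1 < β₂) (hβ₂u : β₂ < 1 / (α - 1))
    (w : ℕ → ℕ → ℝ) (hw : ∀ i j, w i j ≠ 0)
    (hA1 : Tendsto (fun p : ℕ × ℕ => w p.1 p.2) (atTop ×ˢ atTop) (nhds 1))
    (winf : ℕ → ℝ)
    (hA2 : ∀ i, Tendsto (fun j => w i j) atTop (nhds (winf i)) ∧ 0 < winf i)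
    (wco : ℕ → ℝ)
    (hA3 : ∀ j, Tendsto (fun i => w i j) atTop (nhds (wco j)) ∧ 0 < wco j)
    (c : ℕ → ℕ → ℝ)
    (hc : ∀ i j, c i j = w i j * (1 + (i : ℝ)) ^ (-β₁) * (1 + (j : ℝ)) ^ (-β₂))
    (ρ : ℕ → ℕ → ℝ)
    (hsum : ∀ n m : ℕ, 1 ≤ n → 1 ≤ m →
      Summable (fun q : ℕ × ℕ => V α (c (q.1 + n) q.2) (c q.1 (q.2 + m))))
    (hρ : ∀ n m : ℕ, 1 ≤ n → 1 ≤ m →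
      ρ n m = ∑' i : ℕ, ∑' j : ℕ, V α (c (i + n) j) (c i (j + m)))
    (m : ℕ → ℕ) (hm : ∀ n, 1 ≤ m n)
    (hratio : Tendsto (fun n : ℕ => (m n : ℝ) ^ (-β₂) / (n : ℝ) ^ (-β₁))
      atTop (nhds 0))
    :
    Tendsto (fun n : ℕ => ρ n (m n) / ((n : ℝ) ^ (-(β₁ / β₂)) * (m n : ℝ) ^ (1 - β₂ * α)))
      atTop
      (nhds (∑' i : ℕ, ∫ v in Ioi (0 : ℝ), V α (v ^ (-β₂)) (winf i * (1 + (i : ℝ)) ^ (-β₁)))) := by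

  obtain ⟨W, hW, hwW⟩ := w_bound w hA1 winf (fun i => (hA2 i).1) wco (fun j => (hA3 j).1)
  have hα1 : 0 < α - 1 := by linarith
  have hs : 1 < β₁ * (α - 1) := by rwa [div_lt_iff₀ hα1] at hβ₁
  have hs2 : β₂ * (α - 1) < 1 := by rwa [lt_div_iff₀ hα1] at hβ₂u
  have hβ₁0 : 0 < β₁ := by
    by_contra h
    nlinarith
  have hβ₂0 : 0 < β₂ := by linarith
  set J : ℕ → ℝ := fun n => (m n : ℝ) * (n : ℝ) ^ (-(β₁ / β₂)) with hJdef
  have hmp : ∀ n, (0 : ℝ) < m n := fun n => by exact_mod_cast hm n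
  have hJpos : ∀ n : ℕ, 1 ≤ n → 0 < J n := by
    intro n hn
    have : (0 : ℝ) < n := by exact_mod_cast hn
    exact mul_pos (hmp n) (Real.rpow_pos_of_pos this _)
  have hJtop : Tendsto J atTop atTop := by
    have h1 : Tendsto (fun n : ℕ => (m n : ℝ) ^ (-β₂) / (n : ℝ) ^ (-β₁))
        atTop (nhdsWithin 0 (Ioi 0)) := by
      rw [tendsto_nhdsWithin_iff]
      refine ⟨hratio, ?_⟩
      filter_upwards [eventually_ge_atTop 1] with n hn
      have : (0 : ℝ) < n := by exact_mod_cast hn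
      exact div_pos (Real.rpow_pos_of_pos (hmp n) _) (Real.rpow_pos_of_pos this _)
    have h2 := (tendsto_rpow_atTop (y := 1 / β₂) (by positivity)).comp
      (tendsto_inv_nhdsGT_zero.comp h1)
    refine h2.congr' ?_
    filter_upwards [eventually_ge_atTop 1] with n hn
    have hn0 : (0 : ℝ) < n := by exact_mod_cast hn
    have ha := Real.rpow_pos_of_pos (hmp n) (-β₂)
    have hb := Real.rpow_pos_of_pos hn0 (-β₁)
    simp only [Function.comp, hJdef]
    rw [inv_div, Real.div_rpow hb.le ha.le, ← Real.rpow_mul hn0.le, ← Real.rpow_mul (hmp n).le]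
    have e1 : -β₂ * (1 / β₂) = -1 := by field_simp
    have e2 : -β₁ * (1 / β₂) = -(β₁ / β₂) := by ring
    rw [e1, e2, Real.rpow_neg_one, div_inv_eq_mul, mul_comm]
  set G : ℕ → ℕ → ℝ → ℝ := fun n i v =>
    V α (c (i + n) ⌊J n * v⌋₊ * (m n : ℝ) ^ β₂) (c i (⌊J n * v⌋₊ + m n) * (m n : ℝ) ^ β₂) with hG
  have hxf : ∀ n i j : ℕ, 1 ≤ n → c (i + n) j * (m n : ℝ) ^ β₂ =
      w (i + n) j * ((1 + ((i + n : ℕ) : ℝ)) / n) ^ (-β₁) * ((1 + (j : ℝ)) / J n) ^ (-β₂) := by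
    intro n i j hn
    rw [hc]
    exact x_form β₁ β₂ _ n _ (m n) (J n) (by positivity) (by exact_mod_cast hn) (by positivity)
      (hmp n) hβ₂0.ne' rfl _
  have hyf : ∀ n i j : ℕ, c i (j + m n) * (m n : ℝ) ^ β₂ =
      w i (j + m n) * (1 + (i : ℝ)) ^ (-β₁) * ((1 + ((j + m n : ℕ) : ℝ)) / m n) ^ (-β₂) := by
    intro n i j
    rw [hc]
    exact y_form β₁ β₂ _ _ (m n) (by positivity) (hmp n) _
  set K : ℕ → ℝ := fun i => W * W ^ (α - 1) * (1 + (i : ℝ)) ^ (-(β₁ * (α - 1))) with hK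
  have hbound : ∀ n i : ℕ, 1 ≤ n → ∀ v : ℝ, 0 < v → ‖G n i v‖ ≤ K i * Dom α β₂ v := by
    intro n i hn v hv
    have hn0 : (0 : ℝ) < n := by exact_mod_cast hn
    have hJ0 := hJpos n hn
    apply V_dom α β₁ β₂ W v (1 + (i : ℝ)) _ _ hα hα2 hβ₁0 hW hv (by simp)
    · rw [hxf n i _ hn, abs_mul, abs_mul]
      have p1 : (1 : ℝ) ≤ (1 + ((i + n : ℕ) : ℝ)) / n := by
        rw [le_div_iff₀ hn0]
        push_cast
        have : (0 : ℝ) ≤ i := Nat.cast_nonneg i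
        linarith
      have p2 : v ≤ (1 + (⌊J n * v⌋₊ : ℝ)) / J n := by
        rw [le_div_iff₀ hJ0]
        have := Nat.lt_floor_add_one (J n * v)
        linarith
      rw [abs_of_nonneg (Real.rpow_nonneg (by linarith) _),
        abs_of_nonneg (Real.rpow_nonneg (by linarith) _)]
      have q1 := Real.rpow_le_one_of_one_le_of_nonpos p1 (by linarith : -β₁ ≤ 0)
      have q2 := Real.rpow_le_rpow_of_nonpos hv p2 (by linarith : -β₂ ≤ 0)
      have q3 : |w (i + n) ⌊J n * v⌋₊| * ((1 + ((i + n : ℕ) : ℝ)) / n) ^ (-β₁) ≤ W * 1 :=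
        mul_le_mul (hwW _ _) q1 (Real.rpow_nonneg (by linarith) _) hW.le
      rw [mul_one] at q3
      exact mul_le_mul q3 q2 (Real.rpow_nonneg (by linarith) _) hW.le
    · rw [hyf n i _, abs_mul, abs_mul]
      have p1 : (1 : ℝ) ≤ (1 + ((⌊J n * v⌋₊ + m n : ℕ) : ℝ)) / m n := by
        rw [le_div_iff₀ (hmp n)]
        push_cast
        have : (0 : ℝ) ≤ ⌊J n * v⌋₊ := Nat.cast_nonneg _
        linarith
      rw [abs_of_nonneg (Real.rpow_nonneg (by positivity) _),
        abs_of_nonneg (Real.rpow_nonneg (by linarith) _)]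
      have q1 := Real.rpow_le_one_of_one_le_of_nonpos p1 (by linarith : -β₂ ≤ 0)
      have q4 : 0 ≤ (1 + (i : ℝ)) ^ (-β₁) := Real.rpow_nonneg (by positivity) _
      have q3 := mul_le_mul_of_nonneg_right (hwW i (⌊J n * v⌋₊ + m n)) q4
      have q5 := mul_le_mul q3 q1 (Real.rpow_nonneg (by linarith) _) (mul_nonneg hW.le q4)
      rwa [mul_one] at q5
  have hDint := Dom_int α β₂ hβ₂l hs2
  have hmeas : ∀ n i, Measurable (G n i) := by
    intro n i
    have hfl : Measurable (fun v : ℝ => ⌊J n * v⌋₊) :=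
      Nat.measurable_floor.comp (measurable_const_mul (J n))
    apply V_meas
    · exact (measurable_from_nat (f := fun j => c (i + n) j * (m n : ℝ) ^ β₂)).comp hfl
    · exact (measurable_from_nat (f := fun j => c i (j + m n) * (m n : ℝ) ^ β₂)).comp hfl
  have hGint : ∀ n i, 1 ≤ n → IntegrableOn (G n i) (Ioi 0) := by
    intro n i hn
    refine Integrable.mono' (hDint.const_mul (K i)) (hmeas n i).aestronglyMeasurable ?_
    filter_upwards [ae_restrict_mem measurableSet_Ioi] with v hv
    exact hbound n i hn v hv
  have hKsum : Summable K := by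
    apply Summable.mul_left
    have h1 : Summable (fun n : ℕ => (n : ℝ) ^ (-(β₁ * (α - 1)))) :=
      Real.summable_nat_rpow.mpr (by linarith)
    refine ((summable_nat_add_iff 1).mpr h1).congr ?_
    intro i
    push_cast
    rw [add_comm]
  have hmain : Tendsto (fun n => ∑' i, ∫ v in Ioi (0 : ℝ), G n i v) atTop
      (nhds (∑' i : ℕ, ∫ v in Ioi (0 : ℝ),
        V α (v ^ (-β₂)) (winf i * (1 + (i : ℝ)) ^ (-β₁)))) := by
    refine tendsto_tsum_of_dominated_convergence
      (bound := fun i => K i * ∫ v in Ioi (0 : ℝ), Dom α β₂ v) (hKsum.mul_right _) ?_ ?_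
    · intro i
      refine tendsto_integral_filter_of_dominated_convergence (fun v => K i * Dom α β₂ v) ?_ ?_
        (hDint.const_mul (K i)) ?_
      · exact Eventually.of_forall fun n => (hmeas n i).aestronglyMeasurable
      · filter_upwards [eventually_ge_atTop 1] with n hn
        filter_upwards [ae_restrict_mem measurableSet_Ioi] with v hv
        exact hbound n i hn v hv
      · filter_upwards [ae_restrict_mem measurableSet_Ioi] with v hv
        have hv0 : 0 < v := hv
        have hjtop : Tendsto (fun n => ⌊J n * v⌋₊) atTop atTop :=
          tendsto_nat_floor_atTop.comp (hJtop.atTop_mul_const hv0)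
        have hin : Tendsto (fun n : ℕ => i + n) atTop atTop :=
          tendsto_atTop_mono (fun n => Nat.le_add_left n i) tendsto_id
        have hinv : Tendsto (fun n => 1 / J n) atTop (nhds 0) := by
          simp only [one_div]
          exact hJtop.inv_tendsto_atTop
        have hjJ : Tendsto (fun n => (1 + (⌊J n * v⌋₊ : ℝ)) / J n) atTop (nhds v) := by
          have h1 := (tendsto_nat_floor_mul_div_atTop hv0.le).comp hJtop
          have h2 := hinv.add h1
          rw [zero_add] at h2
          refine h2.congr fun n => ?_
          simp only [Function.comp]
          rw [mul_comm v, add_div]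
        apply V_tendsto _ _ _ _ _ (Real.rpow_pos_of_pos hv0 _)
        · have h1 : Tendsto (fun n => w (i + n) ⌊J n * v⌋₊) atTop (nhds 1) :=
            hA1.comp (hin.prodMk hjtop)
          have h2 : Tendsto (fun n : ℕ => (1 + ((i + n : ℕ) : ℝ)) / n) atTop (nhds 1) := by
            have h3 := (tendsto_const_div_atTop_nhds_zero_nat (1 + (i : ℝ))).add_const 1
            rw [zero_add] at h3
            refine h3.congr' ?_
            filter_upwards [eventually_ge_atTop 1] with n hn
            have hn0 : (0 : ℝ) < n := by exact_mod_cast hn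
            push_cast
            field_simp
            try ring
          have h4 := (h1.mul (h2.rpow_const (p := -β₁) (Or.inl one_ne_zero))).mul
            (hjJ.rpow_const (p := -β₂) (Or.inl hv0.ne'))
          rw [Real.one_rpow, one_mul, one_mul] at h4
          refine h4.congr' ?_
          filter_upwards [eventually_ge_atTop 1] with n hn
          rw [hxf n i _ hn]
        · have h1 : Tendsto (fun n => w i (⌊J n * v⌋₊ + m n)) atTop (nhds (winf i)) :=
            (hA2 i).1.comp (tendsto_atTop_mono (fun n => Nat.le_add_right _ _) hjtop)
          have h2 : Tendsto (fun n : ℕ => (1 + ((⌊J n * v⌋₊ + m n : ℕ) : ℝ)) / m n) atTop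
              (nhds 1) := by
            have h5 : Tendsto (fun n : ℕ => (n : ℝ) ^ (-(β₁ / β₂))) atTop (nhds 0) :=
              (tendsto_rpow_neg_atTop (div_pos hβ₁0 hβ₂0)).comp tendsto_natCast_atTop_atTop
            have h3 := (hjJ.mul h5).add_const 1
            rw [mul_zero, zero_add] at h3
            refine h3.congr' ?_
            filter_upwards [eventually_ge_atTop 1] with n hn
            have hn0 : (0 : ℝ) < n := by exact_mod_cast hn
            have hm0 := hmp n
            have hr := Real.rpow_pos_of_pos hn0 (-(β₁ / β₂))
            have hJ0 := hJpos n hn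
            have hJe : (n : ℝ) ^ (-(β₁ / β₂)) = J n / m n := by
              simp only [hJdef]
              field_simp
            rw [hJe]
            push_cast
            generalize J n = j at *
            field_simp
            try ring
          have h4 := (h1.mul_const ((1 + (i : ℝ)) ^ (-β₁))).mul
            (h2.rpow_const (p := -β₂) (Or.inl one_ne_zero))
          rw [Real.one_rpow, mul_one] at h4
          refine h4.congr fun n => ?_
          rw [hyf n i _]
    · filter_upwards [eventually_ge_atTop 1] with n hn i
      rw [← integral_const_mul]
      apply norm_integral_le_of_norm_le (hDint.const_mul (K i))
      filter_upwards [ae_restrict_mem measurableSet_Ioi] with v hv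
      exact hbound n i hn v hv
  refine hmain.congr' ?_
  filter_upwards [eventually_ge_atTop 1] with n hn
  have hn0 : (0 : ℝ) < n := by exact_mod_cast hn
  have hm0 := hmp n
  have hJ0 := hJpos n hn
  have hstep : ∀ i, ∫ v in Ioi (0 : ℝ), G n i v =
      (J n)⁻¹ * ((m n : ℝ) ^ (β₂ * α)) * ∑' j, V α (c (i + n) j) (c i (j + m n)) := by
    intro i
    have := integral_floor_mul (fun j => V α (c (i + n) j * (m n : ℝ) ^ β₂)
      (c i (j + m n) * (m n : ℝ) ^ β₂)) (J n) hJ0 (hGint n i hn)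
    simp only [hG]
    rw [this]
    simp only [V_hom _ _ _ _ (Real.rpow_pos_of_pos hm0 β₂), tsum_mul_left]
    rw [← Real.rpow_mul hm0.le, mul_assoc]
  simp only [hstep, tsum_mul_left]
  rw [hρ n (m n) hn (hm n), div_eq_inv_mul]
  congr 1
  rw [Real.rpow_sub hm0, Real.rpow_one]
  simp only [hJdef]
  have := Real.rpow_pos_of_pos hm0 (β₂ * α)
  have := Real.rpow_pos_of_pos hn0 (-(β₁ / β₂))
  field_simp
end
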